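/- arXiv:2105.06985 — 2 statements merged into one kernel-verified Lean document; each statement's English description precedes it below -/
import Mathlib

section
/- Let y ≥ 0 and assume Δx ≤ 2y. Then I₀(y − Δx/2) ≤ I(y) ≤ I₀(y + Δx/2). -/
open MeasureTheory Real Set

/-- The discretized Gaussian weight `μ(j)`. -/
noncomputable def gaussMu (Δt Δx : ℝ) (j : ℤ) : ℝ :=
  ∫ x in (((j : ℝ) - 1/2) * Δx)..(((j : ℝ) + 1/2) * Δx),
    (Real.sqrt (2 * Real.pi * Δt))⁻¹ * Real.exp (-x ^ 2 / (2 * Δt))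

/-- The log-moment generating function `Λ` of the discretized Gaussian. -/
noncomputable def LambdaFn (Δt Δx : ℝ) (l : ℝ) : ℝ :=
  Real.log (∑' j : ℤ, gaussMu Δt Δx j * Real.exp (l * (j * Δx)))

/-- The convex conjugate (rate function) `I(y) = sup_λ (λy − Λ(λ))`. -/
noncomputable def rateI (Δt Δx : ℝ) (y : ℝ) : ℝ :=
  ⨆ l : ℝ, l * y - LambdaFn Δt Δx l

lemma aux_pdf (t l x : ℝ) (ht : 0 < t) :
    ((Real.sqrt (2 * Real.pi * t))⁻¹ * Real.exp (-x ^ 2 / (2 * t))) * Real.exp (l * x)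
      = Real.exp (l ^ 2 * t / 2) * ProbabilityTheory.gaussianPDFReal (l * t) (NNReal.mk t ht.le) x := by
  have hc : ((NNReal.mk t ht.le) : ℝ) = t := rfl
  rw [ProbabilityTheory.gaussianPDFReal_def]
  simp only [hc]
  rw [ mul_assoc, ← Real.exp_add, mul_left_comm,
    ← Real.exp_add]
  congr 2
  field_simp
  ring

lemma aux_hasSum (t d l : ℝ) (ht : 0 < t) (hd : 0 < d) :
    HasSum (fun j : ℤ => ∫ x in (((j : ℝ) - 1/2) * d)..(((j : ℝ) + 1/2) * d),
      ((Real.sqrt (2 * Real.pi * t))⁻¹ * Real.exp (-x ^ 2 / (2 * t))) * Real.exp (l * x))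
      (Real.exp (l ^ 2 * t / 2)) := by
  have hv : (NNReal.mk t ht.le) ≠ 0 := by
    intro h
    exact ht.ne' (congrArg NNReal.toReal h)
  set f : ℝ → ℝ := fun x =>
    ((Real.sqrt (2 * Real.pi * t))⁻¹ * Real.exp (-x ^ 2 / (2 * t))) * Real.exp (l * x) with hf
  have hfe : f = fun x => Real.exp (l ^ 2 * t / 2) *
      ProbabilityTheory.gaussianPDFReal (l * t) (NNReal.mk t ht.le) x := by
    funext x; exact aux_pdf t l x ht
  have hint : Integrable f := by
    rw [hfe]
    exact (ProbabilityTheory.integrable_gaussianPDFReal _ _).const_mul _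
  have hI : ∫ x, f x = Real.exp (l ^ 2 * t / 2) := by
    rw [hfe, integral_const_mul, ProbabilityTheory.integral_gaussianPDFReal_eq_one _ hv, mul_one]
  have h := ((hint.comp_mul_right' hd.ne').const_mul d).hasSum_intervalIntegral (-1/2)
  have e : ∫ x, d * f (x * d) = Real.exp (l ^ 2 * t / 2) := by
    rw [integral_const_mul, Measure.integral_comp_mul_right, hI, abs_of_pos (inv_pos.2 hd),
      smul_eq_mul, ← mul_assoc, mul_inv_cancel₀ hd.ne', one_mul]
  rw [e] at h
  have hfun : (fun n : ℤ => ∫ x in (-1/2 + (n : ℝ))..(-1/2 + (n : ℝ) + 1), d * f (x * d)) =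
      fun j : ℤ => ∫ x in (((j : ℝ) - 1/2) * d)..(((j : ℝ) + 1/2) * d), f x := by
    funext j
    rw [intervalIntegral.integral_const_mul, intervalIntegral.mul_integral_comp_mul_right]
    congr 1 <;> ring
  rw [hfun] at h
  exact h

lemma aux_cell (t d l : ℝ) (hd : 0 < d) (j : ℤ) :
    Real.exp (-(|l| * d / 2)) * (∫ x in (((j : ℝ) - 1/2) * d)..(((j : ℝ) + 1/2) * d),
      ((Real.sqrt (2 * Real.pi * t))⁻¹ * Real.exp (-x ^ 2 / (2 * t))) * Real.exp (l * x))
      ≤ gaussMu t d j * Real.exp (l * (j * d)) ∧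
    gaussMu t d j * Real.exp (l * (j * d)) ≤
    Real.exp (|l| * d / 2) * (∫ x in (((j : ℝ) - 1/2) * d)..(((j : ℝ) + 1/2) * d),
      ((Real.sqrt (2 * Real.pi * t))⁻¹ * Real.exp (-x ^ 2 / (2 * t))) * Real.exp (l * x)) := by
  have hle : ((j : ℝ) - 1/2) * d ≤ ((j : ℝ) + 1/2) * d := by nlinarith
  have key : ∀ x ∈ Icc (((j : ℝ) - 1/2) * d) (((j : ℝ) + 1/2) * d),
      |l * x - l * (j * d)| ≤ |l| * d / 2 := by
    intro x hx
    rw [← mul_sub, abs_mul, mul_div_assoc]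
    refine mul_le_mul_of_nonneg_left ?_ (abs_nonneg _)
    rw [abs_le]; constructor <;> linarith [hx.1, hx.2]
  unfold gaussMu
  rw [← intervalIntegral.integral_const_mul, ← intervalIntegral.integral_const_mul,
    ← intervalIntegral.integral_mul_const]
  constructor
  · refine intervalIntegral.integral_mono_on hle (Continuous.intervalIntegrable (by fun_prop) _ _)
      (Continuous.intervalIntegrable (by fun_prop) _ _) fun x hx => ?_
    rw [mul_left_comm, ← Real.exp_add]
    refine mul_le_mul_of_nonneg_left (Real.exp_le_exp.2 ?_) (by positivity)
    linarith [(abs_le.1 (key x hx)).2]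
  · refine intervalIntegral.integral_mono_on hle (Continuous.intervalIntegrable (by fun_prop) _ _)
      (Continuous.intervalIntegrable (by fun_prop) _ _) fun x hx => ?_
    rw [mul_left_comm (Real.exp (|l| * d / 2)), ← Real.exp_add]
    refine mul_le_mul_of_nonneg_left (Real.exp_le_exp.2 ?_) (by positivity)
    linarith [(abs_le.1 (key x hx)).1]

lemma aux_Lambda (t d l : ℝ) (ht : 0 < t) (hd : 0 < d) :
    l ^ 2 * t / 2 - |l| * d / 2 ≤ LambdaFn t d l ∧
      LambdaFn t d l ≤ l ^ 2 * t / 2 + |l| * d / 2 := by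
  have h := aux_hasSum t d l ht hd
  have hlo := h.mul_left (Real.exp (-(|l| * d / 2)))
  have hhi := h.mul_left (Real.exp (|l| * d / 2))
  have hs : Summable (fun j : ℤ => gaussMu t d j * Real.exp (l * (j * d))) := by
    refine Summable.of_nonneg_of_le (fun j => ?_) (fun j => (aux_cell t d l hd j).2) hhi.summable
    refine mul_nonneg ?_ (Real.exp_pos _).le
    unfold gaussMu
    refine intervalIntegral.integral_nonneg (by nlinarith) fun x _ => by positivity
  have h1 := hasSum_le (fun j => (aux_cell t d l hd j).1) hlo hs.hasSum
  have h2 := hasSum_le (fun j => (aux_cell t d l hd j).2) hs.hasSum hhi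
  rw [← Real.exp_add] at h1 h2
  have hpos := (Real.exp_pos _).trans_le h1
  unfold LambdaFn
  constructor
  · rw [Real.le_log_iff_exp_le hpos]
    refine le_trans (Real.exp_le_exp.2 ?_) h1
    linarith
  · rw [Real.log_le_iff_le_exp hpos]
    refine h2.trans (Real.exp_le_exp.2 ?_)
    linarith

/-- If `y ≥ 0` and `Δx ≤ 2y`, then `I₀(y − Δx/2) ≤ I(y) ≤ I₀(y + Δx/2)`,
where `I₀(z) = z²/(2Δt)`. -/
theorem stmt_1 (Δt Δx : ℝ) (hΔt : 0 < Δt) (hΔx : 0 < Δx) (y : ℝ) (hy : 0 ≤ y)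
    (hxy : Δx ≤ 2 * y) :
    (y - Δx / 2) ^ 2 / (2 * Δt) ≤ rateI Δt Δx y ∧
      rateI Δt Δx y ≤ (y + Δx / 2) ^ 2 / (2 * Δt) := by
  have hub : ∀ l : ℝ, l * y - LambdaFn Δt Δx l ≤ (y + Δx / 2) ^ 2 / (2 * Δt) := by
    intro l
    have h1 := (aux_Lambda Δt Δx l hΔt hΔx).1
    have h2 : l * y ≤ |l| * y := mul_le_mul_of_nonneg_right (le_abs_self l) hy
    have h3 : |l| * (y + Δx / 2) - |l| ^ 2 * Δt / 2 ≤ (y + Δx / 2) ^ 2 / (2 * Δt) := by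
      rw [le_div_iff₀ (by positivity)]
      nlinarith [sq_nonneg (|l| * Δt - (y + Δx / 2))]
    rw [sq_abs] at h3
    linarith
  constructor
  · have hl : 0 ≤ (y - Δx / 2) / Δt := div_nonneg (by linarith) hΔt.le
    refine le_trans ?_ (le_ciSup (f := fun l : ℝ => l * y - LambdaFn Δt Δx l)
      ⟨_, by rintro _ ⟨l, rfl⟩; exact hub l⟩ ((y - Δx / 2) / Δt))
    have h1 := (aux_Lambda Δt Δx ((y - Δx / 2) / Δt) hΔt hΔx).2
    rw [abs_of_nonneg hl] at h1
    have e : (y - Δx / 2) ^ 2 / (2 * Δt) = (y - Δx / 2) / Δt * y -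
        (((y - Δx / 2) / Δt) ^ 2 * Δt / 2 + (y - Δx / 2) / Δt * Δx / 2) := by
      field_simp
      ring
    linarith
  · exact ciSup_le hub
end

section
/- The function c : (1, ∞) → (0, ∞) that maps m to the unique positive solution of I(c) = log m is continuous on (1, ∞). -/
open MeasureTheory Real Set

theorem aux_hasSum_s18 (Δt Δx : ℝ) (hΔt : 0 < Δt) (hΔx : 0 < Δx) :
    HasSum (gaussMu Δt Δx) 1 := by
  let f : ℝ → ℝ := fun x =>
    (Real.sqrt (2 * Real.pi * Δt))⁻¹ * Real.exp (-x ^ 2 / (2 * Δt))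
  have hf : f = ProbabilityTheory.gaussianPDFReal 0 ⟨Δt, hΔt.le⟩ := by
    funext x
    show _ = (Real.sqrt (2 * Real.pi * Δt))⁻¹ * Real.exp (-(x - 0) ^ 2 / (2 * Δt))
    simp [f]
  have hv : (⟨Δt, hΔt.le⟩ : NNReal) ≠ 0 := by
    intro h
    have h2 : Δt = 0 := congrArg NNReal.toReal h
    linarith
  have hi : Integrable f := by
    rw [hf]; exact ProbabilityTheory.integrable_gaussianPDFReal _ _
  have h1 : ∫ x, f x = 1 := by
    rw [hf]; exact ProbabilityTheory.integral_gaussianPDFReal_eq_one 0 hv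
  have hu := iUnion_Ioc_add_zsmul hΔx (-(1/2) * Δx)
  have hd := pairwise_disjoint_Ioc_add_zsmul (-(1/2) * Δx) Δx
  have hs := hasSum_integral_iUnion (μ := volume) (f := f)
    (fun n => measurableSet_Ioc) hd hi.integrableOn
  rw [hu, setIntegral_univ, h1] at hs
  suffices h : gaussMu Δt Δx = fun n : ℤ =>
      ∫ x in Ioc (-(1/2) * Δx + n • Δx) (-(1/2) * Δx + (n + 1) • Δx), f x by
    rw [h]; exact hs
  funext j
  unfold gaussMu
  rw [intervalIntegral.integral_of_le (by nlinarith)]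
  have e1 : ((j : ℝ) - 1/2) * Δx = -(1/2) * Δx + j • Δx := by
    rw [zsmul_eq_mul]; ring
  have e2 : ((j : ℝ) + 1/2) * Δx = -(1/2) * Δx + (j + 1) • Δx := by
    rw [zsmul_eq_mul]; push_cast; ring
  rw [e1, e2]

theorem aux_neg (Δt Δx : ℝ) (j : ℤ) : gaussMu Δt Δx (-j) = gaussMu Δt Δx j := by
  unfold gaussMu
  have h := intervalIntegral.integral_comp_neg
    (a := ((j : ℝ) - 1/2) * Δx) (b := ((j : ℝ) + 1/2) * Δx)
    (fun x : ℝ => (Real.sqrt (2 * Real.pi * Δt))⁻¹ * Real.exp (-x ^ 2 / (2 * Δt)))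
  simp only [neg_sq] at h
  rw [h]
  congr 1 <;> push_cast <;> ring

theorem aux_nonneg (Δt Δx : ℝ) (hΔx : 0 < Δx) (j : ℤ) : 0 ≤ gaussMu Δt Δx j := by
  unfold gaussMu
  apply intervalIntegral.integral_nonneg (by nlinarith)
  intro x _
  positivity

theorem aux_Lambda_s18 (Δt Δx : ℝ) (hΔt : 0 < Δt) (hΔx : 0 < Δx) (l : ℝ) :
    0 ≤ LambdaFn Δt Δx l := by
  unfold LambdaFn
  by_cases hs : Summable (fun j : ℤ => gaussMu Δt Δx j * Real.exp (l * (j * Δx)))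
  · apply Real.log_nonneg
    have h1 := hs.hasSum
    have h2 := (Equiv.neg ℤ).hasSum_iff.mpr h1
    have h3 := h1.add h2
    have h4 := (aux_hasSum_s18 Δt Δx hΔt hΔx).mul_left 2
    have := hasSum_le (fun j => ?_) h4 h3
    · linarith
    · simp only [Function.comp, Equiv.neg_apply, aux_neg]
      have a1 := Real.add_one_le_exp (l * ((j : ℝ) * Δx))
      have a2 := Real.add_one_le_exp (l * (((-j : ℤ) : ℝ) * Δx))
      have a3 : l * (((-j : ℤ) : ℝ) * Δx) = - (l * ((j : ℝ) * Δx)) := by push_cast; ring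
      have a4 := aux_nonneg Δt Δx hΔx j
      nlinarith
  · rw [tsum_eq_zero_of_not_summable hs]; simp

theorem aux_scale (Δt Δx : ℝ) (hΔt : 0 < Δt) (hΔx : 0 < Δx) (b θ : ℝ)
    (hb : 0 < rateI Δt Δx b) (h0 : 0 ≤ θ) (h1 : θ ≤ 1) :
    rateI Δt Δx (θ * b) ≤ θ * rateI Δt Δx b := by
  have hbdd : BddAbove (Set.range fun l : ℝ => l * b - LambdaFn Δt Δx l) := by
    by_contra h
    unfold rateI at hb
    rw [Real.iSup_of_not_bddAbove h] at hb
    exact lt_irrefl _ hb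
  have key : ∀ l : ℝ, l * b - LambdaFn Δt Δx l ≤ rateI Δt Δx b := fun l => le_ciSup hbdd l
  apply ciSup_le
  intro l
  have := aux_Lambda_s18 Δt Δx hΔt hΔx l
  nlinarith [mul_le_mul_of_nonneg_left (key l) h0, mul_nonneg (sub_nonneg.mpr h1) this]

/-- The function `c : (1,∞) → (0,∞)` mapping `m` to the unique positive solution of
`I(c) = log m` is continuous on `(1,∞)`. -/
theorem stmt_18 (Δt Δx : ℝ) (hΔt : 0 < Δt) (hΔx : 0 < Δx)
    (c : ℝ → ℝ) (hc : ∀ m : ℝ, 1 < m → 0 < c m ∧ rateI Δt Δx (c m) = Real.log m) :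
    ContinuousOn c (Set.Ioi 1) := by
  have key : ∀ p q : ℝ, 1 < p → 1 < q → c p ≤ c q →
      c q * Real.log p ≤ c p * Real.log q := by
    intro p q hp hq h
    obtain ⟨p0, p1⟩ := hc p hp
    obtain ⟨q0, q1⟩ := hc q hq
    have := aux_scale Δt Δx hΔt hΔx (c q) (c p / c q) (by rw [q1]; exact Real.log_pos hq)
      (by positivity) ((div_le_one q0).mpr h)
    rw [div_mul_cancel₀ _ q0.ne', p1, q1, div_mul_eq_mul_div, le_div_iff₀ q0] at this
    linarith
  have mono : ∀ p q : ℝ, 1 < p → p ≤ q → c p ≤ c q := by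
    intro p q hp hpq
    by_contra! h
    have hq := hp.trans_le hpq
    have h1 := key q p hq hp h.le
    have h2 := Real.log_le_log (by linarith) hpq
    have h3 := Real.log_pos hp
    nlinarith [(hc q hq).1]
  intro a ha
  have ha : 1 < a := ha
  have la := Real.log_pos ha
  have cont : Filter.Tendsto (fun m => c a * Real.log m / Real.log a) (nhdsWithin a (Set.Ioi 1))
      (nhds (c a)) := by
    have : ContinuousAt (fun m => c a * Real.log m / Real.log a) a := by
      have := Real.continuousAt_log (x := a) (by linarith)
      fun_prop
    have h2 := this.tendsto
    simp only [mul_div_cancel_right₀ _ la.ne'] at h2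
    exact h2.mono_left nhdsWithin_le_nhds
  have c1 := cont.min (tendsto_const_nhds (x := c a))
  have c2 := cont.max (tendsto_const_nhds (x := c a))
  rw [min_self] at c1
  rw [max_self] at c2
  refine tendsto_of_tendsto_of_tendsto_of_le_of_le' c1 c2 ?_ ?_
  · filter_upwards [self_mem_nhdsWithin] with m hm
    have hm : 1 < m := hm
    rcases le_total m a with h | h
    · apply min_le_of_left_le
      rw [div_le_iff₀ la]
      exact key m a hm ha (mono m a hm h)
    · exact min_le_of_right_le (mono a m ha h)
  · filter_upwards [self_mem_nhdsWithin] with m hm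
    have hm : 1 < m := hm
    rcases le_total m a with h | h
    · exact le_max_of_le_right (mono m a hm h)
    · apply le_max_of_le_left
      rw [le_div_iff₀ la]
      exact key a m ha hm (mono a m ha h)
end
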